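/- arXiv:2201.07733 — 3 statements merged into one kernel-verified Lean document; each statement's English description precedes it below -/
import Mathlib

section
/- Let d ≥ 1, let A be a symmetric positive definite d×d real matrix, and let s, y ∈ ℝ^d with s ≠ 0. Define θ̃ = (0.75·sᵀA⁻¹s)/(sᵀA⁻¹s − sᵀy) if sᵀy ≤ 0.25·sᵀA⁻¹s, and θ̃ = 1 otherwise. Then for every real θ with 0 < θ ≤ θ̃, the damped vector ŷ = θ·y + (1−θ)·A⁻¹s satisfies sᵀŷ ≥ 0.25·sᵀA⁻¹s; in particular sᵀŷ > 0. -/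
open Matrix

/-- for any `θ` with `0 < θ ≤ θ̃`, the damped vector
`ŷ = θ•y + (1-θ)•A⁻¹s` satisfies `sᵀŷ ≥ 0.25·sᵀA⁻¹s > 0`.
Here `A` plays the role of `H⁰ + εI` and is symmetric positive definite. -/
theorem damped_vector_curvature
    (d : ℕ) (hd : 1 ≤ d)
    (A : Matrix (Fin d) (Fin d) ℝ) (hA : A.PosDef)
    (s y : Fin d → ℝ) (hs : s ≠ 0)
    (θtilde : ℝ)
    (hθt : θtilde = if s ⬝ᵥ y ≤ 0.25 * (s ⬝ᵥ A⁻¹.mulVec s) then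
        (0.75 * (s ⬝ᵥ A⁻¹.mulVec s)) / (s ⬝ᵥ A⁻¹.mulVec s - s ⬝ᵥ y)
      else 1) :
    ∀ θ : ℝ, 0 < θ → θ ≤ θtilde →
      0.25 * (s ⬝ᵥ A⁻¹.mulVec s) ≤ s ⬝ᵥ (θ • y + (1 - θ) • A⁻¹.mulVec s) ∧
      0 < s ⬝ᵥ (θ • y + (1 - θ) • A⁻¹.mulVec s) := by
  intro θ hθ_pos hθ_le
  have hq : 0 < s ⬝ᵥ A⁻¹.mulVec s := by
    simpa using hA.inv.dotProduct_mulVec_pos hs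
  rw [dotProduct_add, dotProduct_smul, dotProduct_smul, smul_eq_mul, smul_eq_mul]
  generalize s ⬝ᵥ A⁻¹.mulVec s = q at *
  generalize s ⬝ᵥ y = b at *
  suffices h : 0.25 * q ≤ θ * b + (1 - θ) * q from ⟨h, by linarith⟩
  rw [hθt] at hθ_le
  split_ifs at hθ_le with hb
  · rw [le_div_iff₀ (by linarith)] at hθ_le
    linarith
  · nlinarith [mul_nonneg hθ_pos.le (sub_nonneg.2 (not_le.1 hb).le),
      mul_nonneg (sub_nonneg.2 hθ_le) hq.le]
end

section
/- Let d ≥ 1 and let 0 < β ≤ 𝓑, ε > 0, ρ ≥ 0, and let M ≥ 1 and 1 ≤ M̃ ≤ M be integers. Let H⁽⁰⁾, H⁽¹⁾, …, H⁽^M̃⁾ be symmetric d×d real matrices with β·I ⪯ H⁽⁰⁾ ⪯ 𝓑·I, and suppose for each t = 0, …, M̃−1 there are vectors ŝ_t, ŷ_t ∈ ℝ^d with ŝ_t ≠ 0 and ŝ_tᵀŷ_t ≥ 0.25·‖ŝ_t‖²/(𝓑 + ε), such that H⁽ᵗ⁺¹⁾ = H⁽ᵗ⁾ + ŝ_tŝ_tᵀ/(ŝ_tᵀŷ_t)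 − (H⁽ᵗ⁾ŷ_t)(H⁽ᵗ⁾ŷ_t)ᵀ/(ŷ_tᵀH⁽ᵗ⁾ŷ_t) + ρI. Then H⁽^M̃⁾ ⪯ (𝓑 + M(4𝓑 + 4ε + ρ))·I. -/
open Matrix

section

variable {n : Type*} [Fintype n]

lemma Matrix.posSemidef_vecMulVec_self_real (v : n → ℝ) : (vecMulVec v v).PosSemidef := by
  simpa using posSemidef_vecMulVec_self_star v

/-- The rank-one downdate of a positive semidefinite matrix is positive semidefinite
(a form of the Cauchy–Schwarz inequality). -/
lemma Matrix.PosSemidef.sub_vecMulVec_mulVec {A : Matrix n n ℝ} (hA : A.PosSemidef) (y : n → ℝ) :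
    (A - (y ⬝ᵥ A *ᵥ y)⁻¹ • vecMulVec (A *ᵥ y) (A *ᵥ y)).PosSemidef := by
  refine .of_dotProduct_mulVec_nonneg
    (hA.isHermitian.sub ((posSemidef_vecMulVec_self_real _).isHermitian.smul (.all _))) fun x ↦ ?_
  set c := y ⬝ᵥ A *ᵥ y with hc
  have hsymm : y ⬝ᵥ A *ᵥ x = x ⬝ᵥ A *ᵥ y := by
    have hT : Aᵀ = A := by simpa using hA.isHermitian.eq
    rw [dotProduct_mulVec, ← mulVec_transpose, hT, dotProduct_comm]
  have key := hA.dotProduct_mulVec_nonneg (x - (c⁻¹ * (x ⬝ᵥ A *ᵥ y)) • y)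
  simp only [star_trivial, mulVec_sub, mulVec_smul, sub_dotProduct, dotProduct_sub,
    smul_dotProduct, dotProduct_smul, smul_eq_mul, hsymm, ← hc] at key
  simp only [star_trivial, sub_mulVec, smul_mulVec, vecMulVec_mulVec, dotProduct_sub,
    dotProduct_smul, smul_eq_mul, op_smul_eq_smul, dotProduct_comm (A *ᵥ y) x]
  rcases eq_or_ne c 0 with h | h
  · simpa [h] using key
  · field_simp at key ⊢
    simpa using key

lemma Matrix.posSemidef_smul_one_sub_smul_vecMulVec [DecidableEq n] {s : n → ℝ} (hs : s ≠ 0)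
    {a k : ℝ} (hk : 0 ≤ k) (hak : a * (s ⬝ᵥ s) ≤ k) :
    (k • (1 : Matrix n n ℝ) - a • vecMulVec s s).PosSemidef := by
  have hpos : 0 < s ⬝ᵥ s := by simpa using dotProduct_star_self_pos_iff.2 hs
  have h₁ : ((1 : Matrix n n ℝ) - (s ⬝ᵥ s)⁻¹ • vecMulVec s s).PosSemidef := by
    simpa using (PosSemidef.one (n := n) (R := ℝ)).sub_vecMulVec_mulVec s
  have h₂ : 0 ≤ k * (s ⬝ᵥ s)⁻¹ - a := by
    rw [sub_nonneg, ← div_eq_mul_inv, le_div_iff₀ hpos]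
    exact hak
  convert (h₁.smul hk).add ((posSemidef_vecMulVec_self_real s).smul h₂) using 1
  module

end

/-- upper bound of Theorem 1 (damped regularized limited-memory
DFP).  Starting from `β·I ⪯ H⁽⁰⁾ ⪯ 𝓑·I` and performing `M̃ ≤ M` damped
regularized DFP updates, one has `H⁽^M̃⁾ ⪯ (𝓑 + M(4𝓑 + 4ε + ρ))·I`.
`‖ŝ_t‖² = ŝ_t ⬝ᵥ ŝ_t` is the squared Euclidean norm. -/
theorem dfp_limited_memory_upper_bound
    (d : ℕ) (hd : 1 ≤ d)
    (β B : ℝ) (hβ : 0 < β) (hβB : β ≤ B)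
    (ε : ℝ) (hε : 0 < ε) (ρ : ℝ) (hρ : 0 ≤ ρ)
    (M Mt : ℕ) (hM : 1 ≤ M) (hMt1 : 1 ≤ Mt) (hMtM : Mt ≤ M)
    (H : ℕ → Matrix (Fin d) (Fin d) ℝ)
    (hHsym : ∀ t ≤ Mt, (H t).IsHermitian)
    (hH0l : (H 0 - β • (1 : Matrix (Fin d) (Fin d) ℝ)).PosSemidef)
    (hH0u : (B • (1 : Matrix (Fin d) (Fin d) ℝ) - H 0).PosSemidef)
    (shat yhat : ℕ → (Fin d → ℝ))
    (hs : ∀ t < Mt, shat t ≠ 0)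
    (hsy : ∀ t < Mt, 0.25 * (shat t ⬝ᵥ shat t) / (B + ε) ≤ shat t ⬝ᵥ yhat t)
    (hupd : ∀ t < Mt, H (t + 1) = H t
      + (shat t ⬝ᵥ yhat t)⁻¹ • vecMulVec (shat t) (shat t)
      - (yhat t ⬝ᵥ (H t).mulVec (yhat t))⁻¹ •
          vecMulVec ((H t).mulVec (yhat t)) ((H t).mulVec (yhat t))
      + ρ • (1 : Matrix (Fin d) (Fin d) ℝ)) :
    ((B + (M : ℝ) * (4 * B + 4 * ε + ρ)) • (1 : Matrix (Fin d) (Fin d) ℝ)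
      - H Mt).PosSemidef := by
  have hBε : 0 < B + ε := by linarith
  have hone : (1 : Matrix (Fin d) (Fin d) ℝ).PosSemidef := .one
  have bounds : ∀ t ≤ Mt, (H t).PosSemidef ∧
      ((B + (t : ℝ) * (4 * B + 4 * ε + ρ)) • (1 : Matrix (Fin d) (Fin d) ℝ)
        - H t).PosSemidef := by
    intro t
    induction t with
    | zero =>
      refine fun _ ↦ ⟨?_, by simpa using hH0u⟩
      convert hH0l.add (hone.smul hβ.le) using 1
      module
    | succ t ih =>
      intro ht
      obtain ⟨hpsd, hle⟩ := ih (by omega)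
      have hss : 0 < shat t ⬝ᵥ shat t := by
        simpa using dotProduct_star_self_pos_iff.2 (hs t ht)
      have hcurv := hsy t ht
      have hsy_pos : 0 < shat t ⬝ᵥ yhat t := lt_of_lt_of_le (by positivity) hcurv
      have hbound : (shat t ⬝ᵥ yhat t)⁻¹ * (shat t ⬝ᵥ shat t) ≤ 4 * (B + ε) := by
        rw [inv_mul_le_iff₀ hsy_pos]
        rw [div_le_iff₀ hBε] at hcurv
        linarith
      have hyHy : 0 ≤ yhat t ⬝ᵥ H t *ᵥ yhat t := by
        simpa using hpsd.dotProduct_mulVec_nonneg (yhat t)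
      rw [hupd t ht]
      constructor
      · convert ((hpsd.sub_vecMulVec_mulVec (yhat t)).add
          ((posSemidef_vecMulVec_self_real (shat t)).smul (inv_nonneg.2 hsy_pos.le))).add
          (hone.smul hρ) using 1
        abel
      · convert (hle.add (posSemidef_smul_one_sub_smul_vecMulVec (hs t ht)
          (by positivity) hbound)).add
          ((posSemidef_vecMulVec_self_real (H t *ᵥ yhat t)).smul (inv_nonneg.2 hyHy)) using 1
        push_cast
        module
  have hgap : 0 ≤ ((M : ℝ) - Mt) * (4 * B + 4 * ε + ρ) :=
    mul_nonneg (sub_nonneg.2 (by exact_mod_cast hMtM)) (by linarith)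
  convert (bounds Mt le_rfl).2.add (hone.smul hgap) using 1
  module
end

section
/- Let d ≥ 1, let H be a symmetric positive definite d×d real matrix, and let s, ŷ ∈ ℝ^d satisfy sᵀŷ > 0. Then the damped BFGS update H⁺ = (I − sŷᵀ/(sᵀŷ))·H·(I − ŷsᵀ/(sᵀŷ)) + ssᵀ/(sᵀŷ) is symmetric positive definite. -/
open Matrix

/-- the damped BFGS update
`H⁺ = (I − sŷᵀ/(sᵀŷ)) H (I − ŷsᵀ/(sᵀŷ)) + ssᵀ/(sᵀŷ)` is symmetric positive
definite whenever `H` is and `sᵀŷ > 0`. -/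
theorem bfgs_update_posDef
    (d : ℕ) (hd : 1 ≤ d)
    (H : Matrix (Fin d) (Fin d) ℝ) (hH : H.PosDef)
    (s yhat : Fin d → ℝ) (hsy : 0 < s ⬝ᵥ yhat) :
    ((1 - (s ⬝ᵥ yhat)⁻¹ • vecMulVec s yhat) * H *
        (1 - (s ⬝ᵥ yhat)⁻¹ • vecMulVec yhat s)
      + (s ⬝ᵥ yhat)⁻¹ • vecMulVec s s).PosDef := by
  have hB : (1 - (s ⬝ᵥ yhat)⁻¹ • vecMulVec s yhat) =
      (1 - (s ⬝ᵥ yhat)⁻¹ • vecMulVec yhat s)ᴴ := by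
    simp
  have hc : 0 < (s ⬝ᵥ yhat)⁻¹ := inv_pos.2 hsy
  rw [hB]
  have hBHB := hH.posSemidef.conjTranspose_mul_mul_same
    (1 - (s ⬝ᵥ yhat)⁻¹ • vecMulVec yhat s)
  have hss : ((s ⬝ᵥ yhat)⁻¹ • vecMulVec s s).PosSemidef :=
    (by simpa using posSemidef_vecMulVec_self_star s : (vecMulVec s s).PosSemidef).smul hc.le
  refine .of_dotProduct_mulVec_pos (hBHB.add hss).isHermitian fun x hx => ?_
  have hquad : star x ⬝ᵥ (((s ⬝ᵥ yhat)⁻¹ • vecMulVec s s) *ᵥ x) =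
      (s ⬝ᵥ yhat)⁻¹ * (s ⬝ᵥ x) ^ 2 := by
    simp [smul_mulVec, vecMulVec_mulVec, dotProduct_comm x s, sq]
  rw [add_mulVec, dotProduct_add]
  by_cases hsx : s ⬝ᵥ x = 0
  · refine add_pos_of_pos_of_nonneg ?_ (hss.dotProduct_mulVec_nonneg x)
    have hBx : (1 - (s ⬝ᵥ yhat)⁻¹ • vecMulVec yhat s) *ᵥ x = x := by
      simp [sub_mulVec, smul_mulVec, vecMulVec_mulVec, hsx]
    rw [← mulVec_mulVec, ← mulVec_mulVec, hBx, dotProduct_mulVec, ← star_mulVec, hBx]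
    exact hH.dotProduct_mulVec_pos hx
  · refine add_pos_of_nonneg_of_pos (hBHB.dotProduct_mulVec_nonneg x) ?_
    rw [hquad]
    positivity
end
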